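/- arXiv:1503.06324 — 8 statements merged into one kernel-verified Lean document; each statement's English description precedes it below -/
import Mathlib

section
/- For every real α > 0 and every quantum state ρ in K^f, one has Tr(L·𝔏_L(ρ)·L†) ≤ −2·Tr(L·ρ·L†). -/
/-!
STATEMENT 0: For every real α > 0 and every quantum state ρ in K^f, one has
Tr(L·𝔏_L(ρ)·L†) ≤ −2·Tr(L·ρ·L†).

We work on the space `ℕ →₀ ℂ` of finitely supported sequences (spanned by the
Fock basis vectors `e_n = Finsupp.single n 1`).  The annihilation operator acts
by (aψ)(n) = √(n+1)·ψ(n+1), i.e. a e_n = √n e_{n−1}, and the creation operator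
by a† e_n = √(n+1) e_{n+1}.  L = a² − α²·I, L† = (a†)² − α²·I.
-/

open scoped ComplexOrder

noncomputable section

abbrev FockSpace : Type := ℕ →₀ ℂ

/-- The annihilation operator `a`: `a e_n = √n e_{n-1}` (and `a e_0 = 0`),
equivalently `(a ψ)(n) = √(n+1) ψ(n+1)`. -/
noncomputable def ann : Module.End ℂ FockSpace :=
  Finsupp.lsum ℂ fun n => (Real.sqrt n : ℂ) • Finsupp.lsingle (n - 1)

/-- The creation operator `a†`: `a† e_n = √(n+1) e_{n+1}`,
equivalently `(a† ψ)(n) = √n ψ(n-1)` for `n ≥ 1` and `(a† ψ)(0) = 0`. -/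
noncomputable def cre : Module.End ℂ FockSpace :=
  Finsupp.lsum ℂ fun n => (Real.sqrt (n + 1) : ℂ) • Finsupp.lsingle (n + 1)

/-- `L = a² − α²·I`. -/
noncomputable def Lop (α : ℝ) : Module.End ℂ FockSpace :=
  ann ^ 2 - ((α : ℂ) ^ 2) • 1

/-- `L† = (a†)² − α²·I`. -/
noncomputable def Ldag (α : ℝ) : Module.End ℂ FockSpace :=
  cre ^ 2 - ((α : ℂ) ^ 2) • 1

/-- The Lindblad super-operator `𝔏_A(ρ) = AρA† − (A†Aρ + ρA†A)/2`,
with the adjoint `A†` supplied explicitly. -/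
noncomputable def lind (A Adag ρ : Module.End ℂ FockSpace) : Module.End ℂ FockSpace :=
  A * ρ * Adag - (2⁻¹ : ℂ) • (Adag * A * ρ + ρ * (Adag * A))

/-- Trace: sum of the diagonal entries in the Fock basis. -/
noncomputable def trOp (T : Module.End ℂ FockSpace) : ℂ :=
  ∑' n : ℕ, T (Finsupp.single n 1) n

/-- The ℓ² inner product on finitely supported sequences. -/
noncomputable def ip (ψ φ : FockSpace) : ℂ :=
  ∑' n : ℕ, (starRingEnd ℂ) (ψ n) * φ n

/-- `K^f`: Hermitian operators whose range lies in the span of finitely many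
Fock basis vectors. -/
def MemKf (ρ : Module.End ℂ FockSpace) : Prop :=
  (∀ ψ φ : FockSpace, ip (ρ ψ) φ = ip ψ (ρ φ)) ∧
  ∃ S : Finset ℕ, ∀ ψ : FockSpace, ∀ n ∉ S, ρ ψ n = 0

/-- A quantum state in `K^f`: positive semidefinite element of `K^f` of trace 1. -/
def IsQuantumState (ρ : Module.End ℂ FockSpace) : Prop :=
  MemKf ρ ∧ (∀ ψ : FockSpace, 0 ≤ ip ψ (ρ ψ)) ∧ trOp ρ = 1

lemma ann_single (n : ℕ) (z : ℂ) :
    ann (Finsupp.single n z) = Finsupp.single (n - 1) ((Real.sqrt n : ℂ) * z) := by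
  simp [ann]

lemma cre_single (n : ℕ) (z : ℂ) :
    cre (Finsupp.single n z) = Finsupp.single (n + 1) ((Real.sqrt (n + 1) : ℂ) * z) := by
  simp [cre]

lemma ofReal_sqrt_mul_self {x : ℝ} (hx : 0 ≤ x) : (Real.sqrt x : ℂ) * Real.sqrt x = x := by
  rw [← Complex.ofReal_mul, Real.mul_self_sqrt hx]

/-- The canonical commutation relation. -/
lemma ann_mul_cre : ann * cre = cre * ann + 1 := by
  refine Finsupp.lhom_ext fun n z => ?_
  simp only [Module.End.mul_apply, LinearMap.add_apply, Module.End.one_apply, ann_single,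
    cre_single]
  rcases n with _ | n
  · simp
  · have h₁ := ofReal_sqrt_mul_self (x := (n : ℝ) + 1) (by positivity)
    have h₂ := ofReal_sqrt_mul_self (x := (n : ℝ) + 1 + 1) (by positivity)
    simp only [Nat.add_sub_cancel, Nat.cast_add, Nat.cast_one, ← mul_assoc]
    rw [h₁, h₂, ← Finsupp.single_add]
    congr 1
    push_cast
    ring

section Algebra

variable {R : Type*} [Ring R] [Algebra ℂ R]

lemma sq_mul_sq_of_mul_eq_mul_add_one {a c : R} (h : a * c = c * a + 1) :
    a ^ 2 * c ^ 2 = c ^ 2 * a ^ 2 + (4 : ℂ) • (c * a) + (2 : ℂ) • 1 := by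
  have h₁ : a ^ 2 * c ^ 2 = (c * a) * (c * a) + (3 : ℂ) • (c * a) + (2 : ℂ) • 1 := by
    calc a ^ 2 * c ^ 2 = a * (a * c) * c := by simp only [pow_two, mul_assoc]
      _ = (a * c) * (a * c) + a * c := by
        rw [h, mul_add, mul_one, add_mul, ← mul_assoc a c a, mul_assoc (a * c) a c, h]
      _ = (c * a) * (c * a) + (3 : ℂ) • (c * a) + (2 : ℂ) • 1 := by
        rw [h, add_mul, mul_add, mul_one, one_mul]
        module
  have h₂ : (c * a) * (c * a) = c ^ 2 * a ^ 2 + c * a := by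
    calc (c * a) * (c * a) = c * (a * c) * a := by simp only [mul_assoc]
      _ = c ^ 2 * a ^ 2 + c * a := by
        rw [h]
        simp only [pow_two, mul_add, add_mul, mul_one, mul_assoc]
  rw [h₁, h₂]
  module

lemma sq_sub_mul_sq_sub_of_mul_eq_mul_add_one {a c : R} (h : a * c = c * a + 1) (z : ℂ) :
    (a ^ 2 - z • 1) * (c ^ 2 - z • 1) =
      (c ^ 2 - z • 1) * (a ^ 2 - z • 1) + (4 : ℂ) • (c * a) + (2 : ℂ) • 1 := by
  simp only [sub_mul, mul_sub, smul_mul_assoc, mul_smul_comm, one_mul, mul_one,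
    sq_mul_sq_of_mul_eq_mul_add_one h]
  module

lemma mul_lindblad_mul (L D ρ : R) (z : ℂ) :
    L * (L * ρ * D - z • (D * L * ρ + ρ * (D * L))) * D =
      (L * L) * ρ * (D * D) - z • ((L * D * L) * ρ * D + L * ρ * (D * L * D)) := by
  simp only [mul_sub, sub_mul, mul_add, add_mul, mul_smul_comm, smul_mul_assoc, mul_assoc]

lemma mul_mul_of_commutator {L D a c : R}
    (h : L * D = D * L + (4 : ℂ) • (c * a) + (2 : ℂ) • 1) (ρ : R) :
    D * L * D * L * ρ =
      D * D * (L * L) * ρ + ((4 : ℂ) • (D * c * (a * L) * ρ) + (2 : ℂ) • (D * L * ρ)) := by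
  rw [mul_assoc D L D, h]
  simp only [mul_add, add_mul, mul_smul_comm, smul_mul_assoc, mul_assoc, mul_one, add_assoc]

end Algebra

/-- The range of `T` lies in the span of finitely many Fock basis vectors. -/
def FiniteRange (T : Module.End ℂ FockSpace) : Prop :=
  ∃ S : Finset ℕ, ∀ ψ : FockSpace, ∀ n ∉ S, T ψ n = 0

lemma apply_eq_sum (B : Module.End ℂ FockSpace) (v : FockSpace) {S : Finset ℕ}
    (hv : ∀ k ∉ S, v k = 0) (n : ℕ) :
    B v n = ∑ k ∈ S, v k * B (Finsupp.single k 1) n := by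
  have hsub : v.support ⊆ S := fun k hk => by
    by_contra h
    exact Finsupp.mem_support_iff.mp hk (hv k h)
  have h : v = ∑ k ∈ S, v k • Finsupp.single k (1 : ℂ) := by
    conv_lhs => rw [← Finsupp.sum_single v, Finsupp.sum_of_support_subset _ hsub _ (by simp)]
    simp
  conv_lhs => rw [h]
  simp only [map_sum, map_smul, Finsupp.finsetSum_apply, Finsupp.smul_apply, smul_eq_mul]

namespace FiniteRange

variable {T U : Module.End ℂ FockSpace}

lemma mul_right (hT : FiniteRange T) (B : Module.End ℂ FockSpace) : FiniteRange (T * B) := by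
  obtain ⟨S, hS⟩ := hT
  exact ⟨S, fun ψ n hn => hS (B ψ) n hn⟩

lemma mul_left (hT : FiniteRange T) (A : Module.End ℂ FockSpace) : FiniteRange (A * T) := by
  obtain ⟨S, hS⟩ := hT
  refine ⟨S.biUnion fun k => (A (Finsupp.single k 1)).support, fun ψ n hn => ?_⟩
  rw [Module.End.mul_apply, apply_eq_sum A (T ψ) (hS ψ)]
  refine Finset.sum_eq_zero fun k hk => ?_
  have h : n ∉ (A (Finsupp.single k 1)).support := fun h =>
    hn (Finset.mem_biUnion.mpr ⟨k, hk, h⟩)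
  rw [Finsupp.notMem_support_iff.mp h, mul_zero]

lemma summable (hT : FiniteRange T) : Summable fun n : ℕ => T (Finsupp.single n 1) n := by
  obtain ⟨S, hS⟩ := hT
  exact summable_of_ne_finset_zero (s := S) fun n hn => hS _ n hn

lemma add (hT : FiniteRange T) (hU : FiniteRange U) : FiniteRange (T + U) := by
  obtain ⟨S, hS⟩ := hT
  obtain ⟨S', hS'⟩ := hU
  refine ⟨S ∪ S', fun ψ n hn => ?_⟩
  rw [Finset.mem_union, not_or] at hn
  simp [hS ψ n hn.1, hS' ψ n hn.2]

lemma smul (hT : FiniteRange T) (c : ℂ) : FiniteRange (c • T) := by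
  obtain ⟨S, hS⟩ := hT
  exact ⟨S, fun ψ n hn => by simp [hS ψ n hn]⟩

lemma trOp_add (hT : FiniteRange T) (hU : FiniteRange U) :
    trOp (T + U) = trOp T + trOp U := by
  simpa [trOp] using hT.summable.tsum_add hU.summable

lemma trOp_sub (hT : FiniteRange T) (hU : FiniteRange U) :
    trOp (T - U) = trOp T - trOp U := by
  simpa [trOp] using hT.summable.tsum_sub hU.summable

end FiniteRange

lemma trOp_smul (c : ℂ) (T : Module.End ℂ FockSpace) : trOp (c • T) = c * trOp T := by
  simp [trOp, tsum_mul_left]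

/-- Cyclicity of the trace for operators with finitely many nonzero matrix entries. -/
lemma trOp_mul_comm {F : Module.End ℂ FockSpace} (hF : FiniteRange F) {S : Finset ℕ}
    (hS : ∀ k ∉ S, F (Finsupp.single k 1) = 0) (B : Module.End ℂ FockSpace) :
    trOp (F * B) = trOp (B * F) := by
  obtain ⟨T, hT⟩ := hF
  have h₁ : ∀ n, (F * B) (Finsupp.single n 1) n =
      ∑ k ∈ S, B (Finsupp.single n 1) k * F (Finsupp.single k 1) n := fun n => by
    rw [Module.End.mul_apply, apply_eq_sum F _ (S := S ∪ (B (Finsupp.single n 1)).support)]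
    · refine (Finset.sum_subset Finset.subset_union_left fun k _ hk => ?_).symm
      simp [hS k hk]
    · intro k hk
      rw [Finset.mem_union, not_or] at hk
      exact Finsupp.notMem_support_iff.mp hk.2
  have h₂ : ∀ k, (B * F) (Finsupp.single k 1) k =
      ∑ n ∈ T, F (Finsupp.single k 1) n * B (Finsupp.single n 1) k := fun k => by
    rw [Module.End.mul_apply, apply_eq_sum B _ (hT _)]
  unfold trOp
  rw [tsum_eq_sum (s := T) fun n hn => by rw [Module.End.mul_apply]; exact hT _ n hn,
    tsum_eq_sum (s := S) fun k hk => by rw [Module.End.mul_apply, hS k hk]; simp]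
  simp only [h₁, h₂]
  rw [Finset.sum_comm]
  simp only [mul_comm]

lemma ip_single_left (n : ℕ) (z : ℂ) (φ : FockSpace) :
    ip (Finsupp.single n z) φ = (starRingEnd ℂ) z * φ n := by
  unfold ip
  rw [tsum_eq_single n fun m hm => by simp [Finsupp.single_eq_of_ne hm]]
  simp

lemma ip_single_right (n : ℕ) (z : ℂ) (ψ : FockSpace) :
    ip ψ (Finsupp.single n z) = (starRingEnd ℂ) (ψ n) * z := by
  unfold ip
  rw [tsum_eq_single n fun m hm => by simp [Finsupp.single_eq_of_ne hm]]
  simp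

lemma summable_ip (ψ φ : FockSpace) : Summable fun n : ℕ => (starRingEnd ℂ) (ψ n) * φ n :=
  summable_of_ne_finset_zero (s := φ.support) fun n hn => by
    rw [Finsupp.notMem_support_iff.mp hn, mul_zero]

lemma ip_add_left (ψ ψ' φ : FockSpace) : ip (ψ + ψ') φ = ip ψ φ + ip ψ' φ := by
  simpa [ip, add_mul] using (summable_ip ψ φ).tsum_add (summable_ip ψ' φ)

lemma ip_add_right (ψ φ φ' : FockSpace) : ip ψ (φ + φ') = ip ψ φ + ip ψ φ' := by
  simpa [ip, mul_add] using (summable_ip ψ φ).tsum_add (summable_ip ψ φ')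

lemma ip_smul_left (c : ℂ) (ψ φ : FockSpace) : ip (c • ψ) φ = (starRingEnd ℂ) c * ip ψ φ := by
  simp [ip, mul_assoc, tsum_mul_left]

lemma ip_smul_right (c : ℂ) (ψ φ : FockSpace) : ip ψ (c • φ) = c * ip ψ φ := by
  simp [ip, mul_left_comm, tsum_mul_left]

lemma ip_cre_left (ψ φ : FockSpace) : ip (cre ψ) φ = ip ψ (ann φ) := by
  induction ψ using Finsupp.induction_linear with
  | zero => simp [ip]
  | add f g hf hg => rw [map_add, ip_add_left, ip_add_left, hf, hg]
  | single m z =>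
    induction φ using Finsupp.induction_linear with
    | zero => simp [ip]
    | add f g hf hg => rw [map_add, ip_add_right, ip_add_right, hf, hg]
    | single n w =>
      rw [cre_single, ann_single, ip_single_left, ip_single_left]
      rcases n with _ | n
      · simp
      · by_cases h : m = n
        · subst h
          simp
          ring
        · rw [Finsupp.single_eq_of_ne (by omega), Finsupp.single_eq_of_ne (by omega)]
          simp

lemma ip_Ldag_left (α : ℝ) (ψ φ : FockSpace) : ip (Ldag α ψ) φ = ip ψ (Lop α φ) := by
  have h₁ : Ldag α ψ = cre (cre ψ) + (-(α : ℂ) ^ 2) • ψ := by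
    simp [Ldag, pow_two, sub_eq_add_neg]
  have h₂ : Lop α φ = ann (ann φ) + (-(α : ℂ) ^ 2) • φ := by
    simp [Lop, pow_two, sub_eq_add_neg]
  rw [h₁, h₂, ip_add_left, ip_add_right, ip_smul_left, ip_smul_right, ip_cre_left, ip_cre_left]
  simp

/-- If `B` is the formal adjoint of `A` and `ρ` is positive, then `Tr(A ρ B) ≥ 0`. -/
lemma trOp_conj_nonneg {A B ρ : Module.End ℂ FockSpace}
    (hAB : ∀ ψ φ, ip (B ψ) φ = ip ψ (A φ)) (hρ : ∀ ψ, 0 ≤ ip ψ (ρ ψ)) :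
    0 ≤ trOp (A * ρ * B) := by
  refine tsum_nonneg fun n => ?_
  have h := hρ (B (Finsupp.single n 1))
  rw [hAB, ip_single_left] at h
  simpa using h

lemma MemKf.exists_apply_single_eq_zero {ρ : Module.End ℂ FockSpace} (hρ : MemKf ρ) :
    ∃ S : Finset ℕ, ∀ k ∉ S, ρ (Finsupp.single k 1) = 0 := by
  obtain ⟨hsymm, S, hS⟩ := hρ
  refine ⟨S, fun k hk => Finsupp.ext fun n => ?_⟩
  have h := hsymm (Finsupp.single n 1) (Finsupp.single k 1)
  rw [ip_single_left, ip_single_right, hS _ k hk] at h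
  simpa using h.symm

lemma MemKf.trOp_cyclic {ρ : Module.End ℂ FockSpace} (hρ : MemKf ρ)
    (A B : Module.End ℂ FockSpace) : trOp (A * ρ * B) = trOp (B * A * ρ) := by
  obtain ⟨S, hS⟩ := hρ.exists_apply_single_eq_zero
  have hF : FiniteRange ρ := hρ.2
  rw [trOp_mul_comm (hF.mul_left A) (S := S) (fun k hk => by simp [hS k hk]) B, mul_assoc]

theorem stmt0 (α : ℝ) (hα : 0 < α) (ρ : Module.End ℂ FockSpace)
    (hρ : IsQuantumState ρ) :
    trOp (Lop α * lind (Lop α) (Ldag α) ρ * Ldag α) ≤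
      -2 * trOp (Lop α * ρ * Ldag α) := by
  obtain ⟨hK, hpos, -⟩ := hρ
  have hF : FiniteRange ρ := hK.2
  have hfin : ∀ A B, FiniteRange (A * ρ * B) := fun A B => (hF.mul_left A).mul_right B
  have hfin' : ∀ A, FiniteRange (A * ρ) := fun A => hF.mul_left A
  have hnum : 0 ≤ trOp ((ann * Lop α) * ρ * (Ldag α * cre)) :=
    trOp_conj_nonneg (fun ψ φ => by
      rw [Module.End.mul_apply, ip_Ldag_left, ip_cre_left, Module.End.mul_apply]) hpos
  rw [hK.trOp_cyclic] at hnum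
  have hlind : Lop α * lind (Lop α) (Ldag α) ρ * Ldag α =
      (Lop α * Lop α) * ρ * (Ldag α * Ldag α) -
        (2⁻¹ : ℂ) • ((Lop α * Ldag α * Lop α) * ρ * Ldag α +
          Lop α * ρ * (Ldag α * Lop α * Ldag α)) :=
    mul_lindblad_mul (Lop α) (Ldag α) ρ 2⁻¹
  have hcomm : Ldag α * Lop α * Ldag α * Lop α * ρ =
      Ldag α * Ldag α * (Lop α * Lop α) * ρ +
        ((4 : ℂ) • (Ldag α * cre * (ann * Lop α) * ρ) + (2 : ℂ) • (Ldag α * Lop α * ρ)) :=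
    mul_mul_of_commutator (sq_sub_mul_sq_sub_of_mul_eq_mul_add_one ann_mul_cre _) ρ
  have hassoc : Ldag α * (Lop α * Ldag α * Lop α) * ρ = Ldag α * Lop α * Ldag α * Lop α * ρ := by
    simp only [mul_assoc]
  have hadd := (hfin (Lop α * Ldag α * Lop α) (Ldag α)).add
    (hfin (Lop α) (Ldag α * Lop α * Ldag α))
  rw [hlind, FiniteRange.trOp_sub (hfin _ _) (hadd.smul _), trOp_smul,
    FiniteRange.trOp_add (hfin _ _) (hfin _ _), hK.trOp_cyclic, hK.trOp_cyclic, hK.trOp_cyclic,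
    hK.trOp_cyclic, hassoc, hcomm,
    FiniteRange.trOp_add (hfin' _) (((hfin' _).smul _).add ((hfin' _).smul _)),
    FiniteRange.trOp_add ((hfin' _).smul _) ((hfin' _).smul _), trOp_smul, trOp_smul]
  rw [← sub_nonneg]
  have h := mul_nonneg (show (0 : ℂ) ≤ 4 by norm_num) hnum
  convert h using 1
  ring

end
end

section
/- Let ν ≥ 1 be a real number and define g : ℝ → ℝ by g(x) = x^ν − (x−2)^ν for x ≥ 2, g(x) = x^ν for 0 ≤ x < 2, and g(x) = 0 for x < 0. Then g(x−2)·(x+1) ≤ g(x)·(x+3) for all x ≥ 0. -/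
/-!
STATEMENT 5: Let ν ≥ 1 be a real number and define g : ℝ → ℝ by
g(x) = x^ν − (x−2)^ν for x ≥ 2, g(x) = x^ν for 0 ≤ x < 2, and g(x) = 0 for
x < 0.  Then g(x−2)·(x+1) ≤ g(x)·(x+3) for all x ≥ 0.
(Here x^ν denotes the real power function.)
-/

noncomputable def gfun (ν : ℝ) (x : ℝ) : ℝ :=
  if x < 0 then 0 else if x < 2 then x ^ ν else x ^ ν - (x - 2) ^ ν

theorem stmt5 (ν : ℝ) (hν : 1 ≤ ν) (x : ℝ) (hx : 0 ≤ x) :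
    gfun ν (x - 2) * (x + 1) ≤ gfun ν x * (x + 3) := by
  have key : ∀ y : ℝ, 0 ≤ y → y ^ ν = y ^ (ν - 1) * y := fun y hy => by
    rw [← Real.rpow_add_one' hy (by linarith), sub_add_cancel]
  rcases lt_or_ge x 2 with h2 | h2
  · have h : 0 ≤ x ^ ν := Real.rpow_nonneg hx ν
    rw [gfun, if_pos (by linarith), gfun, if_neg (not_lt.2 hx), if_pos h2, zero_mul]
    positivity
  rw [gfun, if_neg (by linarith), gfun, if_neg (not_lt.2 hx), if_neg (not_lt.2 h2)]
  rcases lt_or_ge x 4 with h4 | h4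
  · rw [if_pos (by linarith), key x hx, key (x - 2) (by linarith)]
    have hA : (x - 2) ^ (ν - 1) ≤ x ^ (ν - 1) :=
      Real.rpow_le_rpow (by linarith) (by linarith) (by linarith)
    have hB : 0 ≤ x ^ (ν - 1) := Real.rpow_nonneg hx _
    have h₁ := mul_le_mul_of_nonneg_right hA (show 0 ≤ 2 * x ^ 2 - 8 by nlinarith)
    have h₂ := mul_le_mul_of_nonneg_left
      (show 2 * x ^ 2 - 8 ≤ x ^ 2 + 3 * x by nlinarith) hB
    linarith
  · rw [if_neg (by linarith)]
    have hconv := (convexOn_rpow hν).2 (show x ∈ Set.Ici (0 : ℝ) from hx)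
      (show x - 2 - 2 ∈ Set.Ici (0 : ℝ) from Set.mem_Ici.2 (by linarith))
      (show (0 : ℝ) ≤ 1 / 2 by norm_num) (show (0 : ℝ) ≤ 1 / 2 by norm_num) (by norm_num)
    simp only [smul_eq_mul] at hconv
    rw [show 1 / 2 * x + 1 / 2 * (x - 2 - 2) = x - 2 by ring] at hconv
    have hmono : (x - 2) ^ ν ≤ x ^ ν :=
      Real.rpow_le_rpow (by linarith) (by linarith) (by linarith)
    exact mul_le_mul (by linarith) (by linarith) (by linarith) (by linarith)
end

section
/- Let ν ≥ 1, κ > 0 and μ > 0 be real numbers, and let y : [0,∞) → [0,∞) be a differentiable function satisfying y′(t) ≤ κ·(−ν·y(t)^((ν+1)/ν) + μ) for all t ≥ 0. Then y(t) ≤ max((μ/ν)^(ν/(ν+1)), y(0)) for all t ≥ 0. -/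
/-!
STATEMENT 8: Let ν ≥ 1, κ > 0 and μ > 0 be real numbers, and let
y : [0,∞) → [0,∞) be a differentiable function satisfying
y′(t) ≤ κ·(−ν·y(t)^((ν+1)/ν) + μ) for all t ≥ 0.  Then
y(t) ≤ max((μ/ν)^(ν/(ν+1)), y(0)) for all t ≥ 0.
-/

/-- A differentiable function whose derivative is negative wherever its value exceeds `M` stays
below `M` if it starts there. -/
theorem le_of_deriv_neg_of_lt {y : ℝ → ℝ} {a M : ℝ}
    (hdiff : ∀ t, a ≤ t → DifferentiableAt ℝ y t) (ha : y a ≤ M)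
    (hneg : ∀ t, a ≤ t → M < y t → deriv y t < 0) {t : ℝ} (ht : a ≤ t) : y t ≤ M := by
  refine le_of_forall_pos_le_add fun ε hε => ?_
  refine image_le_of_deriv_right_lt_deriv_boundary (f' := deriv y) (B := fun _ => M + ε)
    (B' := fun _ => 0) (a := a) (b := t)
    (fun s hs => (hdiff s hs.1).continuousAt.continuousWithinAt)
    (fun s hs => (hdiff s hs.1).hasDerivAt.hasDerivWithinAt) (by linarith)
    (fun s => hasDerivAt_const s _) (fun s hs h => hneg s hs.1 (by linarith)) ⟨ht, le_rfl⟩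

theorem stmt8 (ν κ μ : ℝ) (hν : 1 ≤ ν) (hκ : 0 < κ) (hμ : 0 < μ)
    (y : ℝ → ℝ) (hy : ∀ t, 0 ≤ t → 0 ≤ y t)
    (hdiff : ∀ t, 0 ≤ t → DifferentiableAt ℝ y t)
    (hder : ∀ t, 0 ≤ t → deriv y t ≤ κ * (-ν * y t ^ ((ν + 1) / ν) + μ)) :
    ∀ t, 0 ≤ t → y t ≤ max ((μ / ν) ^ (ν / (ν + 1))) (y 0) := by
  intro t ht
  have hν₀ : 0 < ν := by linarith
  refine le_of_deriv_neg_of_lt hdiff (le_max_right _ _) (fun s hs h => ?_) ht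
  have hlt : (μ / ν) ^ (ν / (ν + 1)) < y s := (le_max_left _ _).trans_lt h
  have hpow : μ / ν < y s ^ ((ν + 1) / ν) :=
    (Real.rpow_inv_lt_iff_of_pos (by positivity) (hy s hs) (by positivity)).1 (by rwa [inv_div])
  rw [div_lt_iff₀ hν₀] at hpow
  exact (hder s hs).trans_lt (mul_neg_of_pos_of_neg hκ (by linarith))
end

section
/- Fix a real α > 0, let w₊, w₋ : ℕ → ℂ be the coherent-state sequences w₊(n) = e^(−α²/2)·α^n/√(n!) and w₋(n) = e^(−α²/2)·(−α)^n/√(n!), and define the cat states c⁺ = (w₊ + w₋)/γ⁺ and c⁻ = (w₊ − w₋)/γ⁻, where γ^± = √(2(1 ± e^(−2α²))). Then c⁺ and c⁻ are orthonormal in ℓ²(ℕ, ℂ): ⟨c⁺, c⁻⟩ = 0 and ‖c⁺‖ = ‖c⁻‖ = 1. -/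
/-!
STATEMENT 11: Fix a real α > 0, let w₊, w₋ : ℕ → ℂ be the coherent-state
sequences w₊(n) = e^(−α²/2)·α^n/√(n!) and w₋(n) = e^(−α²/2)·(−α)^n/√(n!), and
define the cat states c⁺ = (w₊ + w₋)/γ⁺ and c⁻ = (w₊ − w₋)/γ⁻, where
γ^± = √(2(1 ± e^(−2α²))).  Then c⁺ and c⁻ are orthonormal in ℓ²(ℕ, ℂ):
⟨c⁺, c⁻⟩ = 0 and ‖c⁺‖ = ‖c⁻‖ = 1, the inner product being
⟨ψ, φ⟩ = ∑_n conj(ψ(n))·φ(n).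
-/

noncomputable section

/-- The coherent state `|α⟩`: `w₊(n) = e^(−α²/2)·α^n/√(n!)`. -/
noncomputable def wP (α : ℝ) : ℕ → ℂ :=
  fun n => (Real.exp (-α ^ 2 / 2) : ℂ) * (α : ℂ) ^ n / (Real.sqrt n.factorial : ℂ)

/-- The coherent state `|−α⟩`: `w₋(n) = e^(−α²/2)·(−α)^n/√(n!)`. -/
noncomputable def wM (α : ℝ) : ℕ → ℂ :=
  fun n => (Real.exp (-α ^ 2 / 2) : ℂ) * (-α : ℂ) ^ n / (Real.sqrt n.factorial : ℂ)

/-- `γ⁺ = √(2(1 + e^(−2α²)))`. -/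
noncomputable def gammaP (α : ℝ) : ℝ := Real.sqrt (2 * (1 + Real.exp (-2 * α ^ 2)))

/-- `γ⁻ = √(2(1 − e^(−2α²)))`. -/
noncomputable def gammaM (α : ℝ) : ℝ := Real.sqrt (2 * (1 - Real.exp (-2 * α ^ 2)))

/-- The even cat state `c⁺ = (w₊ + w₋)/γ⁺`. -/
noncomputable def catP (α : ℝ) : ℕ → ℂ := fun n => (wP α n + wM α n) / (gammaP α : ℂ)

/-- The odd cat state `c⁻ = (w₊ − w₋)/γ⁻`. -/
noncomputable def catM (α : ℝ) : ℕ → ℂ := fun n => (wP α n - wM α n) / (gammaM α : ℂ)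

/-- The overlap `⟨x, y⟩ = e^(−(x−y)²/2)` of two coherent states with real parameters. -/
lemma hasSum_conj_wP_mul_wP (x y : ℝ) :
    HasSum (fun n => (starRingEnd ℂ) (wP x n) * wP y n)
      (Real.exp (-(x - y) ^ 2 / 2) : ℂ) := by
  have h : HasSum (fun n : ℕ => Real.exp (-x ^ 2 / 2) * Real.exp (-y ^ 2 / 2) *
      ((x * y) ^ n / n.factorial)) (Real.exp (-(x - y) ^ 2 / 2)) := by
    have key : Real.exp (-(x - y) ^ 2 / 2) =
        Real.exp (-x ^ 2 / 2) * Real.exp (-y ^ 2 / 2) * Real.exp (x * y) := by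
      rw [← Real.exp_add, ← Real.exp_add]
      ring_nf
    rw [key, Real.exp_eq_exp_ℝ]
    exact (NormedSpace.expSeries_div_hasSum_exp (x * y)).mul_left _
  convert Complex.hasSum_ofReal.mpr h using 2 with n
  have hs : (Real.sqrt n.factorial : ℂ) * (Real.sqrt n.factorial : ℂ) = n.factorial := by
    rw [← Complex.ofReal_mul, Real.mul_self_sqrt (Nat.cast_nonneg _), Complex.ofReal_natCast]
  simp only [wP, map_div₀, map_mul, map_pow, Complex.conj_ofReal]
  rw [div_mul_div_comm, hs]
  push_cast
  ring

lemma wM_eq_wP_neg (α : ℝ) : wM α = wP (-α) := by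
  funext n
  simp [wM, wP]

lemma hasSum_conj_wP_mul_wP_self (x : ℝ) :
    HasSum (fun n => (starRingEnd ℂ) (wP x n) * wP x n) 1 := by
  simpa using hasSum_conj_wP_mul_wP x x

lemma hasSum_conj_wP_mul_wP_neg (x : ℝ) :
    HasSum (fun n => (starRingEnd ℂ) (wP x n) * wP (-x) n) (Real.exp (-2 * x ^ 2) : ℂ) := by
  convert hasSum_conj_wP_mul_wP x (-x) using 3
  ring

lemma hasSum_conj_wP_neg_mul_wP (x : ℝ) :
    HasSum (fun n => (starRingEnd ℂ) (wP (-x) n) * wP x n) (Real.exp (-2 * x ^ 2) : ℂ) := by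
  simpa using hasSum_conj_wP_mul_wP_neg (-x)

lemma gammaP_mul_self (α : ℝ) :
    (gammaP α : ℂ) * gammaP α = 2 * (1 + (Real.exp (-2 * α ^ 2) : ℂ)) := by
  rw [← Complex.ofReal_mul, gammaP, Real.mul_self_sqrt (by positivity)]
  push_cast
  rfl

lemma gammaM_mul_self (α : ℝ) :
    (gammaM α : ℂ) * gammaM α = 2 * (1 - (Real.exp (-2 * α ^ 2) : ℂ)) := by
  have h : Real.exp (-2 * α ^ 2) ≤ 1 := Real.exp_le_one_iff.mpr (by nlinarith [sq_nonneg α])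
  rw [← Complex.ofReal_mul, gammaM, Real.mul_self_sqrt (by linarith)]
  push_cast
  rfl

lemma gammaP_ne_zero (α : ℝ) : (gammaP α : ℂ) ≠ 0 := by
  rw [Complex.ofReal_ne_zero, gammaP]
  positivity

lemma gammaM_ne_zero {α : ℝ} (hα : α ≠ 0) : (gammaM α : ℂ) ≠ 0 := by
  have h : Real.exp (-2 * α ^ 2) < 1 :=
    Real.exp_lt_one_iff.mpr (by nlinarith [sq_pos_of_ne_zero hα])
  rw [Complex.ofReal_ne_zero, gammaM]
  exact (Real.sqrt_pos.mpr (by linarith)).ne'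

theorem stmt11 (α : ℝ) (hα : 0 < α) :
    (∑' n : ℕ, (starRingEnd ℂ) (catP α n) * catM α n = 0) ∧
    (∑' n : ℕ, (starRingEnd ℂ) (catP α n) * catP α n = 1) ∧
    (∑' n : ℕ, (starRingEnd ℂ) (catM α n) * catM α n = 1) := by
  have hpp := hasSum_conj_wP_mul_wP_self α
  have hmm := hasSum_conj_wP_mul_wP_self (-α)
  have hpm := hasSum_conj_wP_mul_wP_neg α
  have hmp := hasSum_conj_wP_neg_mul_wP α
  refine ⟨?_, ?_, ?_⟩
  · refine (tsum_congr fun n => ?_).trans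
      ((((hpp.sub hpm).add (hmp.sub hmm)).div_const ((gammaP α : ℂ) * gammaM α)).tsum_eq.trans ?_)
    · simp only [catP, catM, wM_eq_wP_neg, map_div₀, map_add, Complex.conj_ofReal]
      ring
    · ring
  · refine (tsum_congr fun n => ?_).trans
      ((((hpp.add hpm).add (hmp.add hmm)).div_const ((gammaP α : ℂ) * gammaP α)).tsum_eq.trans ?_)
    · simp only [catP, wM_eq_wP_neg, map_div₀, map_add, Complex.conj_ofReal]
      ring
    · rw [div_eq_iff (mul_ne_zero (gammaP_ne_zero α) (gammaP_ne_zero α)), gammaP_mul_self]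
      ring
  · refine (tsum_congr fun n => ?_).trans
      ((((hpp.sub hpm).sub (hmp.sub hmm)).div_const ((gammaM α : ℂ) * gammaM α)).tsum_eq.trans ?_)
    · simp only [catM, wM_eq_wP_neg, map_div₀, map_sub, Complex.conj_ofReal]
      ring
    · rw [div_eq_iff (mul_ne_zero (gammaM_ne_zero hα.ne') (gammaM_ne_zero hα.ne')),
        gammaM_mul_self]
      ring

end
end

section
/- Let A₁ (m×n), A₂ (n×n, invertible), B₀ (m×m), B₁ (m×n), B₂ (n×n), B₃ (n×m) be real matrices and ε ∈ ℝ. Let x₁ : ℝ → ℝ^m and x₂ : ℝ → ℝ^n be differentiable and satisfy ẋ₁ = A₁x₂ + ε(B₁x₂ + B₀x₁) and ẋ₂ = A₂x₂ + ε(B₂x₂ + B₃x₁). Then the new variables x̃₁ = x₁ − A₁A₂⁻¹x₂ and x̃₂ = x₂ satisfy the Tikhonov normal form: d/dt x̃₁ = ε·((B₀ − A₁A₂⁻¹B₃)·x̃₁ + (B₁ + B₀A₁A₂⁻¹ − A₁A₂⁻¹B₂ − A₁A₂⁻¹B₃A₁A₂⁻¹)·x̃₂) and d/dt x̃₂ =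 A₂x̃₂ + ε·(B₃x̃₁ + (B₂ + B₃A₁A₂⁻¹)·x̃₂). -/
/-!
STATEMENT 15: With ẋ₁ = A₁x₂ + ε(B₁x₂ + B₀x₁) and ẋ₂ = A₂x₂ + ε(B₂x₂ + B₃x₁)
(A₂ invertible), the variables x̃₁ = x₁ − A₁A₂⁻¹x₂ and x̃₂ = x₂ satisfy the
Tikhonov normal form
  d/dt x̃₁ = ε·((B₀ − A₁A₂⁻¹B₃)x̃₁
             + (B₁ + B₀A₁A₂⁻¹ − A₁A₂⁻¹B₂ − A₁A₂⁻¹B₃A₁A₂⁻¹)x̃₂)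
  d/dt x̃₂ = A₂x̃₂ + ε·(B₃x̃₁ + (B₂ + B₃A₁A₂⁻¹)x̃₂).
-/

theorem HasDerivAt.matrix_mulVec {m n : ℕ} (K : Matrix (Fin m) (Fin n) ℝ)
    {x : ℝ → Fin n → ℝ} {x' : Fin n → ℝ} {t : ℝ} (h : HasDerivAt x x' t) :
    HasDerivAt (fun s => K.mulVec (x s)) (K.mulVec x') t :=
  (LinearMap.toContinuousLinearMap K.mulVecLin).hasFDerivAt.comp_hasDerivAt t h

theorem stmt15 {m n : ℕ} (A₁ : Matrix (Fin m) (Fin n) ℝ)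
    (A₂ : Matrix (Fin n) (Fin n) ℝ) (hA₂ : IsUnit A₂)
    (B₀ : Matrix (Fin m) (Fin m) ℝ) (B₁ : Matrix (Fin m) (Fin n) ℝ)
    (B₂ : Matrix (Fin n) (Fin n) ℝ) (B₃ : Matrix (Fin n) (Fin m) ℝ) (ε : ℝ)
    (x₁ : ℝ → Fin m → ℝ) (x₂ : ℝ → Fin n → ℝ)
    (h₁ : ∀ t, HasDerivAt x₁
      (A₁.mulVec (x₂ t) + ε • (B₁.mulVec (x₂ t) + B₀.mulVec (x₁ t))) t)
    (h₂ : ∀ t, HasDerivAt x₂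
      (A₂.mulVec (x₂ t) + ε • (B₂.mulVec (x₂ t) + B₃.mulVec (x₁ t))) t) :
    (∀ t, HasDerivAt (fun s => x₁ s - (A₁ * A₂⁻¹).mulVec (x₂ s))
      (ε • ((B₀ - A₁ * A₂⁻¹ * B₃).mulVec (x₁ t - (A₁ * A₂⁻¹).mulVec (x₂ t)) +
        (B₁ + B₀ * (A₁ * A₂⁻¹) - A₁ * A₂⁻¹ * B₂
          - A₁ * A₂⁻¹ * B₃ * (A₁ * A₂⁻¹)).mulVec (x₂ t))) t) ∧
    (∀ t, HasDerivAt x₂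
      (A₂.mulVec (x₂ t) + ε • (B₃.mulVec (x₁ t - (A₁ * A₂⁻¹).mulVec (x₂ t)) +
        (B₂ + B₃ * (A₁ * A₂⁻¹)).mulVec (x₂ t))) t) := by
  refine ⟨fun t => ?_, fun t => ?_⟩
  · have hK : A₁ * A₂⁻¹ * A₂ = A₁ :=
      Matrix.nonsing_inv_mul_cancel_right A₂ A₁ ((Matrix.isUnit_iff_isUnit_det A₂).mp hA₂)
    refine ((h₁ t).sub ((h₂ t).matrix_mulVec (A₁ * A₂⁻¹))).congr_deriv ?_
    rw [Matrix.mulVec_add, Matrix.mulVec_mulVec, hK]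
    generalize A₁ * A₂⁻¹ = K
    simp only [Matrix.mulVec_add, Matrix.mulVec_sub, Matrix.add_mulVec, Matrix.sub_mulVec,
      Matrix.mulVec_smul, Matrix.mulVec_mulVec, Matrix.sub_mul,
      Matrix.mul_assoc]
    module
  · refine (h₂ t).congr_deriv ?_
    simp only [Matrix.mulVec_sub, Matrix.add_mulVec, Matrix.mulVec_mulVec]
    module
end

section
/- Let q > 0 be real and let X be the 2×2 complex matrix with entries X₁₂ = q, X₂₁ = 1/q, X₁₁ = X₂₂ = 0. Then for every Hermitian 2×2 matrix ρ: Tr(𝔏_X(ρ)·σ_x) = −((q − 1/q)²/2)·Tr(ρ·σ_x), Tr(𝔏_X(ρ)·σ_y) = −((q + 1/q)²/2)·Tr(ρ·σ_y), and Tr(𝔏_X(ρ)·σ_z) = −(q² + 1/q²)·Tr(ρ·σ_z) + (q² − 1/q²)·Tr(ρ). -/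
/-!
STATEMENT 17: Let q > 0 and X the 2×2 matrix with X₁₂ = q, X₂₁ = 1/q,
X₁₁ = X₂₂ = 0.  Then for every Hermitian 2×2 matrix ρ:
Tr(𝔏_X(ρ)·σ_x) = −((q − 1/q)²/2)·Tr(ρ·σ_x),
Tr(𝔏_X(ρ)·σ_y) = −((q + 1/q)²/2)·Tr(ρ·σ_y),
Tr(𝔏_X(ρ)·σ_z) = −(q² + 1/q²)·Tr(ρ·σ_z) + (q² − 1/q²)·Tr(ρ).
-/

noncomputable section

/-- The matrix `X` with `X₁₂ = q`, `X₂₁ = 1/q`, zero diagonal. -/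
noncomputable def Xq (q : ℝ) : Matrix (Fin 2) (Fin 2) ℂ :=
  !![0, (q : ℂ); ((1 / q : ℝ) : ℂ), 0]

/-- The Lindblad super-operator `𝔏_X(ρ) = XρX† − (X†Xρ + ρX†X)/2` on 2×2
matrices, with `X†` the conjugate transpose. -/
noncomputable def lindM (X ρ : Matrix (Fin 2) (Fin 2) ℂ) : Matrix (Fin 2) (Fin 2) ℂ :=
  X * ρ * X.conjTranspose -
    (2⁻¹ : ℂ) • (X.conjTranspose * X * ρ + ρ * (X.conjTranspose * X))

/-- The Pauli matrix `σ_x`. -/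
def sigmaX : Matrix (Fin 2) (Fin 2) ℂ := !![0, 1; 1, 0]

/-- The Pauli matrix `σ_y`. -/
def sigmaY : Matrix (Fin 2) (Fin 2) ℂ := !![0, -Complex.I; Complex.I, 0]

/-- The Pauli matrix `σ_z`. -/
def sigmaZ : Matrix (Fin 2) (Fin 2) ℂ := !![1, 0; 0, -1]

theorem Xq_conjTranspose (q : ℝ) :
    (Xq q).conjTranspose = !![0, ((1 / q : ℝ) : ℂ); (q : ℂ), 0] := by
  ext i j
  fin_cases i <;> fin_cases j <;> simp [Xq]

theorem stmt17 (q : ℝ) (hq : 0 < q) (ρ : Matrix (Fin 2) (Fin 2) ℂ)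
    (hρ : ρ.IsHermitian) :
    (lindM (Xq q) ρ * sigmaX).trace
        = -(((q - 1 / q) ^ 2 / 2 : ℝ) : ℂ) * (ρ * sigmaX).trace ∧
    (lindM (Xq q) ρ * sigmaY).trace
        = -(((q + 1 / q) ^ 2 / 2 : ℝ) : ℂ) * (ρ * sigmaY).trace ∧
    (lindM (Xq q) ρ * sigmaZ).trace
        = -((q ^ 2 + 1 / q ^ 2 : ℝ) : ℂ) * (ρ * sigmaZ).trace
          + ((q ^ 2 - 1 / q ^ 2 : ℝ) : ℂ) * ρ.trace := by
  have hq' : (q : ℂ) ≠ 0 := by exact_mod_cast hq.ne'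
  rw [lindM, Xq_conjTranspose, Matrix.eta_fin_two ρ]
  refine ⟨?_, ?_, ?_⟩ <;>
  · simp [Xq, sigmaX, sigmaY, sigmaZ, Matrix.trace_fin_two]
    field_simp
    ring

end
end

section
/- Let q > 0 with q ≠ 1 and let X be the 2×2 complex matrix with entries X₁₂ = q, X₂₁ = 1/q, X₁₁ = X₂₂ = 0. Then the unique 2×2 density matrix ρ (positive semidefinite Hermitian with trace 1) satisfying 𝔏_X(ρ) = 0 is the diagonal matrix ρ = diag(q⁴/(1+q⁴), 1/(1+q⁴)). -/
/-!
STATEMENT 18: Let q > 0, q ≠ 1, and X the 2×2 matrix with X₁₂ = q, X₂₁ = 1/q,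
X₁₁ = X₂₂ = 0.  Then the unique 2×2 density matrix ρ (positive semidefinite
Hermitian with trace 1) satisfying 𝔏_X(ρ) = 0 is
ρ = diag(q⁴/(1+q⁴), 1/(1+q⁴)).
-/

open scoped ComplexOrder

noncomputable section

/-- The claimed steady state `diag(q⁴/(1+q⁴), 1/(1+q⁴))`. -/
noncomputable def steadyState (q : ℝ) : Matrix (Fin 2) (Fin 2) ℂ :=
  Matrix.diagonal ![((q ^ 4 / (1 + q ^ 4) : ℝ) : ℂ), ((1 / (1 + q ^ 4) : ℝ) : ℂ)]

/-- The matrix entries of the Lindblad super-operator for the jump matrix `Xq q`. -/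
theorem lindM_Xq_apply (q : ℝ) (hq : q ≠ 0) (ρ : Matrix (Fin 2) (Fin 2) ℂ) :
    lindM (Xq q) ρ =
      !![(q : ℂ) ^ 2 * ρ 1 1 - ρ 0 0 / (q : ℂ) ^ 2,
          ρ 1 0 - ((q : ℂ) ^ 2 + 1 / (q : ℂ) ^ 2) / 2 * ρ 0 1;
        ρ 0 1 - ((q : ℂ) ^ 2 + 1 / (q : ℂ) ^ 2) / 2 * ρ 1 0,
          ρ 0 0 / (q : ℂ) ^ 2 - (q : ℂ) ^ 2 * ρ 1 1] := by
  have hqc : (q : ℂ) ≠ 0 := by exact_mod_cast hq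
  ext i j
  fin_cases i <;> fin_cases j <;>
    simp [lindM, Xq, Matrix.mul_apply, Matrix.vecMul, dotProduct] <;> field_simp <;> ring

theorem steadyState_posSemidef (q : ℝ) : (steadyState q).PosSemidef := by
  refine Matrix.PosSemidef.diagonal fun i => ?_
  fin_cases i
  · exact Complex.zero_le_real.2 (by positivity)
  · exact Complex.zero_le_real.2 (by positivity)

theorem one_add_pow_four_ne_zero (q : ℝ) : (1 + (q : ℂ) ^ 4) ≠ 0 := by
  exact_mod_cast (by positivity : (1 + q ^ 4 : ℝ) ≠ 0)

theorem steadyState_trace (q : ℝ) : (steadyState q).trace = 1 := by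
  have h := one_add_pow_four_ne_zero q
  simp [steadyState]
  field_simp
  ring

theorem lindM_Xq_steadyState (q : ℝ) (hq : q ≠ 0) : lindM (Xq q) (steadyState q) = 0 := by
  have hqc : (q : ℂ) ≠ 0 := by exact_mod_cast hq
  have h := one_add_pow_four_ne_zero q
  rw [lindM_Xq_apply q hq]
  ext i j
  fin_cases i <;> fin_cases j <;> simp [steadyState] <;> field_simp <;> ring

/-- Unit-trace matrices annihilated by the Lindblad super-operator are the steady state. -/
theorem eq_steadyState_of_lindM_eq_zero (q : ℝ) (hq : 0 < q) (hq1 : q ≠ 1)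
    (ρ : Matrix (Fin 2) (Fin 2) ℂ) (htr : ρ.trace = 1) (hρ : lindM (Xq q) ρ = 0) :
    ρ = steadyState q := by
  have hqc : (q : ℂ) ≠ 0 := by exact_mod_cast hq.ne'
  have h4 := one_add_pow_four_ne_zero q
  have hd : (q : ℂ) ^ 4 - 1 ≠ 0 := by
    have : q ^ 4 ≠ 1 := fun h => hq1 ((pow_eq_one_iff_of_nonneg hq.le (by norm_num)).1 h)
    exact_mod_cast sub_ne_zero.2 this
  rw [lindM_Xq_apply q hq.ne'] at hρ
  have h00 : (q : ℂ) ^ 2 * ρ 1 1 - ρ 0 0 / (q : ℂ) ^ 2 = 0 := congrFun₂ hρ 0 0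
  have h01 : ρ 1 0 - ((q : ℂ) ^ 2 + 1 / (q : ℂ) ^ 2) / 2 * ρ 0 1 = 0 := congrFun₂ hρ 0 1
  have h10 : ρ 0 1 - ((q : ℂ) ^ 2 + 1 / (q : ℂ) ^ 2) / 2 * ρ 1 0 = 0 := congrFun₂ hρ 1 0
  rw [Matrix.trace_fin_two] at htr
  field_simp at h00 h01 h10
  have hb : ρ 0 1 = 0 := by
    have : ((q : ℂ) ^ 4 - 1) ^ 2 * ρ 0 1 = 0 := by
      linear_combination -2 * (q : ℂ) ^ 2 * h10 - ((q : ℂ) ^ 4 + 1) * h01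
    exact (mul_eq_zero.1 this).resolve_left (pow_ne_zero 2 hd)
  have hc : ρ 1 0 = 0 := by
    rw [hb] at h01
    simpa [hqc] using h01
  have h1 : ρ 1 1 = 1 / (1 + (q : ℂ) ^ 4) := by
    rw [eq_div_iff h4]
    linear_combination htr + h00
  have h0 : ρ 0 0 = (q : ℂ) ^ 4 / (1 + (q : ℂ) ^ 4) := by
    rw [eq_div_iff h4]
    linear_combination (q : ℂ) ^ 4 * htr - h00
  ext i j
  fin_cases i <;> fin_cases j <;> simp [steadyState, h0, h1, hb, hc]

theorem stmt18 (q : ℝ) (hq : 0 < q) (hq1 : q ≠ 1) :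
    ((steadyState q).PosSemidef ∧ (steadyState q).trace = 1 ∧
      lindM (Xq q) (steadyState q) = 0) ∧
    (∀ ρ : Matrix (Fin 2) (Fin 2) ℂ, ρ.PosSemidef → ρ.trace = 1 →
      lindM (Xq q) ρ = 0 → ρ = steadyState q) := by
  exact ⟨⟨steadyState_posSemidef q, steadyState_trace q, lindM_Xq_steadyState q hq.ne'⟩,
    fun ρ _ htr hρ => eq_steadyState_of_lindM_eq_zero q hq hq1 ρ htr hρ⟩

end
end

section
/- Let E be a finite-dimensional complex inner product space, P an orthogonal projection on E (P = P† = P²), A : E → E a linear map with P·A·P = A·P, ξ a self-adjoint operator on E commuting with P, and ρ an operator on E with ρ = PρP. Then Tr(ξ·(𝔏_A(ρ) − P·𝔏_A(ρ)·P)) = 0. -/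
/-!
STATEMENT 19: Let E be a finite-dimensional complex inner product space, P an
orthogonal projection on E (P = P† = P²), A : E → E a linear map with
P·A·P = A·P, ξ a self-adjoint operator commuting with P, and ρ an operator with
ρ = PρP.  Then Tr(ξ·(𝔏_A(ρ) − P·𝔏_A(ρ)·P)) = 0.
-/

noncomputable section

/-- The Lindblad super-operator `𝔏_A(ρ) = AρA† − (A†Aρ + ρA†A)/2` on a
finite-dimensional inner product space. -/
noncomputable def lindF {E : Type*} [NormedAddCommGroup E] [InnerProductSpace ℂ E]
    [FiniteDimensional ℂ E] (A ρ : E →ₗ[ℂ] E) : E →ₗ[ℂ] E :=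
  A * ρ * LinearMap.adjoint A -
    (2⁻¹ : ℂ) • (LinearMap.adjoint A * A * ρ + ρ * (LinearMap.adjoint A * A))

/-- If `ξ` commutes with `P` and `X * P = X`, compressing `X` by `P` preserves its trace
against `ξ`. -/
theorem LinearMap.trace_mul_compress_of_mul_eq {R M : Type*} [CommRing R] [AddCommGroup M]
    [Module R M] {P ξ X : M →ₗ[R] M} (hcomm : ξ * P = P * ξ) (hX : X * P = X) :
    LinearMap.trace R M (ξ * (P * X * P)) = LinearMap.trace R M (ξ * X) := by
  rw [mul_assoc P, hX, ← mul_assoc, hcomm, mul_assoc, LinearMap.trace_mul_comm, mul_assoc, hX]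

/-- If `ξ` commutes with `P` and `P * X = X`, compressing `X` by `P` preserves its trace
against `ξ`. -/
theorem LinearMap.trace_mul_compress_of_eq_mul {R M : Type*} [CommRing R] [AddCommGroup M]
    [Module R M] {P ξ X : M →ₗ[R] M} (hcomm : ξ * P = P * ξ) (hX : P * X = X) :
    LinearMap.trace R M (ξ * (P * X * P)) = LinearMap.trace R M (ξ * X) := by
  rw [hX, ← mul_assoc, LinearMap.trace_mul_comm, ← mul_assoc, ← hcomm, mul_assoc, hX]

theorem stmt19 {E : Type*} [NormedAddCommGroup E] [InnerProductSpace ℂ E]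
    [FiniteDimensional ℂ E] (P A ξ ρ : E →ₗ[ℂ] E)
    (hP1 : LinearMap.adjoint P = P) (hP2 : P * P = P)
    (hA : P * A * P = A * P)
    (hξ : LinearMap.adjoint ξ = ξ) (hcomm : ξ * P = P * ξ)
    (hρ : P * ρ * P = ρ) :
    LinearMap.trace ℂ E (ξ * (lindF A ρ - P * lindF A ρ * P)) = 0 := by
  have hρP : ρ * P = ρ := by rw [← hρ, mul_assoc, hP2]
  have hPρ : P * ρ = ρ := by rw [← hρ, ← mul_assoc, ← mul_assoc, hP2]
  have hA' : P * LinearMap.adjoint A * P = P * LinearMap.adjoint A := by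
    have h := congrArg LinearMap.adjoint hA
    simpa only [Module.End.mul_eq_comp, LinearMap.adjoint_comp, hP1, LinearMap.comp_assoc] using h
  have hJump : A * ρ * LinearMap.adjoint A * P = A * ρ * LinearMap.adjoint A := by
    rw [← hρP]
    simp only [mul_assoc] at hA' ⊢
    rw [hA']
  have hLeft : LinearMap.adjoint A * A * ρ * P = LinearMap.adjoint A * A * ρ := by
    rw [mul_assoc, hρP]
  have hRight : P * (ρ * (LinearMap.adjoint A * A)) = ρ * (LinearMap.adjoint A * A) := by
    rw [← mul_assoc, hPρ]
  simp only [lindF, mul_sub, sub_mul, mul_add, add_mul, mul_smul_comm, smul_mul_assoc,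
    map_sub, map_add, map_smul]
  rw [LinearMap.trace_mul_compress_of_mul_eq hcomm hJump,
    LinearMap.trace_mul_compress_of_mul_eq hcomm hLeft,
    LinearMap.trace_mul_compress_of_eq_mul hcomm hRight, sub_self]

end
end
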